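/- Let (X, 𝓑, μ, f) be a dissipative system of bounded distortion generated by W, with f bijective and both f and f⁻¹ satisfying condition (⋆), and let 1 ≤ p < ∞. Then the composition operator T_f on L^p(X, μ) is generalized hyperbolic if and only if T_f has the shadowing property. -/

import Mathlib

open MeasureTheory Filter Set Function Topology ENNReal

noncomputable section

namespace GHShadow

/-- The shadowing property for an invertible bounded linear operator. -/
def HasShadowing {E : Type*} [NormedAddCommGroup E] [NormedSpace ℝ E]
    (T : E ≃L[ℝ] E) : Prop :=
  ∀ ε : ℝ, 0 < ε → ∃ δ : ℝ, 0 < δ ∧ ∀ x : ℤ → E,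
    (∀ n : ℤ, ‖T (x n) - x (n + 1)‖ ≤ δ) →
      ∃ y : E, ∀ n : ℤ, ‖(T ^ n) y - x n‖ < ε

/-- `lim ‖Tⁿ‖^{1/n}` exists and is `< 1`. -/
def SpectralRadiusLtOne {E : Type*} [NormedAddCommGroup E] [NormedSpace ℝ E]
    (T : E →L[ℝ] E) : Prop :=
  ∃ r : ℝ, r < 1 ∧ Tendsto (fun n : ℕ => ‖T ^ n‖ ^ (1 / (n : ℝ))) atTop (nhds r)

/-- The restriction of `T` to `M` has spectral radius `< 1`
(equivalently, is a proper contraction in an equivalent norm). -/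
def ContractsOn {E : Type*} [NormedAddCommGroup E] [NormedSpace ℝ E]
    (T : E ≃L[ℝ] E) (M : Submodule ℝ E) : Prop :=
  ∃ C : ℝ, 0 < C ∧ ∃ t : ℝ, 0 < t ∧ t < 1 ∧
    ∀ n : ℕ, ∀ x ∈ M, ‖(T ^ n) x‖ ≤ C * t ^ n * ‖x‖

def GeneralizedHyperbolic {E : Type*} [NormedAddCommGroup E] [NormedSpace ℝ E]
    (T : E ≃L[ℝ] E) : Prop :=
  ∃ M N : Submodule ℝ E, IsClosed (M : Set E) ∧ IsClosed (N : Set E) ∧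
    IsCompl M N ∧ (∀ x ∈ M, T x ∈ M) ∧ (∀ x ∈ N, T.symm x ∈ N) ∧
    ContractsOn T M ∧ ContractsOn T.symm N

variable {X : Type*} [MeasurableSpace X]

/-- image of `B` under the `k`-th iterate of the invertible map `f`. -/
def img (f : Equiv.Perm X) (k : ℤ) (B : Set X) : Set X := ⇑(f ^ k) '' B

/-- `(X, 𝓑, μ, f)` is a dissipative system generated by `W`. -/
structure IsDissipative (μ : Measure X) (f : Equiv.Perm X) (W : Set X) : Prop where
  sigmaFin : SigmaFinite μ
  meas_f : Measurable f
  meas_symm : Measurable f.symm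
  meas_W : MeasurableSet W
  pos : 0 < μ W
  fin : μ W < ⊤
  disj : Pairwise fun k l : ℤ => Disjoint (img f k W) (img f l W)
  cover : (⋃ k : ℤ, img f k W) = univ

/-- `f` is of bounded distortion on `W` with constant `K`. -/
def BoundedDistortion (μ : Measure X) (f : Equiv.Perm X) (W : Set X) (K : ℝ≥0∞) : Prop :=
  ∀ k : ℤ, ∀ B : Set X, MeasurableSet B → B ⊆ W →
    (1 / K) * (μ (img f k W) * μ B) ≤ μ (img f k B) * μ W ∧
      μ (img f k B) * μ W ≤ K * (μ (img f k W) * μ B)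

/-- condition (⋆) for a transformation `g`. -/
def CondStar (μ : Measure X) (g : X → X) : Prop :=
  ∃ c : ℝ≥0∞, 0 < c ∧ c ≠ ⊤ ∧ ∀ B : Set X, MeasurableSet B → μ (g ⁻¹' B) ≤ c * μ B

/-- condition 𝓗𝓒. -/
def CondHC (μ : Measure X) (f : Equiv.Perm X) (W : Set X) : Prop :=
  limsup (fun n : ℕ =>
    ⨆ k : ℤ, (μ (img f k W) / μ (img f (k + (n : ℤ)) W)) ^ (1 / (n : ℝ))) atTop < 1

/-- condition 𝓗𝓓. -/
def CondHD (μ : Measure X) (f : Equiv.Perm X) (W : Set X) : Prop :=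
  1 < liminf (fun n : ℕ =>
    ⨅ k : ℤ, (μ (img f k W) / μ (img f (k + (n : ℤ)) W)) ^ (1 / (n : ℝ))) atTop

/-- condition 𝓖𝓗. -/
def CondGH (μ : Measure X) (f : Equiv.Perm X) (W : Set X) : Prop :=
  limsup (fun n : ℕ =>
      ⨆ m : ℕ, (μ (img f (-(m : ℤ) - (n : ℤ)) W) / μ (img f (-(m : ℤ)) W)) ^ (1 / (n : ℝ)))
      atTop < 1 ∧
  1 < liminf (fun n : ℕ =>
      ⨅ m : ℕ, (μ (img f (m : ℤ) W) / μ (img f ((m : ℤ) + (n : ℤ)) W)) ^ (1 / (n : ℝ))) atTop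

/-- `T` represents the composition operator `φ ↦ φ ∘ f` on `L^p(X,μ)`. -/
def RepsComp (μ : Measure X) (p : ℝ≥0∞) [Fact (1 ≤ p)] (f : X → X)
    (T : Lp ℝ p μ ≃L[ℝ] Lp ℝ p μ) : Prop :=
  ∀ φ : Lp ℝ p μ, ⇑(T φ) =ᵐ[μ] fun x => (φ : X → ℝ) (f x)

section BanachSpace

variable {E : Type*} [NormedAddCommGroup E] [NormedSpace ℝ E]

lemma ContractsOn.exists_bounded_solution [CompleteSpace E] {T : E ≃L[ℝ] E} {M : Submodule ℝ E}
    (h : ContractsOn T M) : ∃ B : ℝ, 0 ≤ B ∧ ∀ (d : ℝ) (g : ℤ → E), (∀ n, g n ∈ M) →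
      (∀ n, ‖g n‖ ≤ d) → ∃ u : ℤ → E, (∀ n, u (n + 1) = T (u n) + g n) ∧ ∀ n, ‖u n‖ ≤ B * d := by
  obtain ⟨C, hC, t, ht0, ht1, hT⟩ := h
  refine ⟨C * (1 - t)⁻¹, by have := sub_pos.2 ht1; positivity, fun d g hgM hgd => ?_⟩
  have hbound : ∀ (n : ℤ) (k : ℕ), ‖(T ^ k) (g (n - 1 - k))‖ ≤ C * d * t ^ k := fun n k => by
    calc _ ≤ C * t ^ k * ‖g (n - 1 - k)‖ := hT k _ (hgM _)
      _ ≤ C * t ^ k * d := by gcongr; exact hgd _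
      _ = _ := by ring
  have hgeo : HasSum (fun k : ℕ => C * d * t ^ k) (C * d * (1 - t)⁻¹) :=
    (hasSum_geometric_of_lt_one ht0.le ht1).mul_left _
  have hsum : ∀ n : ℤ, Summable fun k : ℕ => (T ^ k) (g (n - 1 - k)) := fun n =>
    Summable.of_norm_bounded hgeo.summable (hbound n)
  refine ⟨fun n => ∑' k : ℕ, (T ^ k) (g (n - 1 - k)), fun n => ?_, fun n => ?_⟩
  · beta_reduce
    rw [(hsum (n + 1)).tsum_eq_zero_add, T.map_tsum, add_comm]
    congr 1
    · refine tsum_congr fun k => ?_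
      rw [pow_succ', show n + 1 - 1 - ((k + 1 : ℕ) : ℤ) = n - 1 - k by push_cast; ring]
      rfl
    · simp only [CharP.cast_eq_zero, sub_zero, add_sub_cancel_right, pow_zero]
      rfl
  · calc _ ≤ C * d * (1 - t)⁻¹ := tsum_of_norm_bounded hgeo (hbound n)
      _ = _ := by ring

lemma eq_zpow_apply_of_step {T : E ≃L[ℝ] E} {w : ℤ → E} (hw : ∀ n, w (n + 1) = T (w n)) (n : ℤ) :
    w n = (T ^ n) (w 0) := by
  induction n using Int.induction_on with
  | zero => rfl
  | succ n ih =>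
    rw [hw, ih, add_comm, zpow_add, zpow_one]; rfl
  | pred n ih =>
    have h1 : T (w (-n - 1)) = (T ^ (-n : ℤ)) (w 0) := by rw [← hw, ← ih]; simp
    have h2 : T ((T ^ (-n - 1 : ℤ)) (w 0)) = (T ^ (-n : ℤ)) (w 0) := by
      conv_rhs => rw [show (-n : ℤ) = 1 + (-n - 1) by ring, zpow_add, zpow_one]
      rfl
    exact T.injective (h1.trans h2.symm)

theorem GeneralizedHyperbolic.hasShadowing [CompleteSpace E] {T : E ≃L[ℝ] E}
    (h : GeneralizedHyperbolic T) : HasShadowing T := by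
  obtain ⟨M, N, hM, hN, hMN, -, hTN, hcM, hcN⟩ := h
  obtain ⟨B₁, hB₁, h₁⟩ := hcM.exists_bounded_solution
  obtain ⟨B₂, hB₂, h₂⟩ := hcN.exists_bounded_solution
  have hc : Submodule.IsTopCompl M N := Submodule.IsCompl.isTopCompl_of_isClosed hMN hM hN
  let P : E →L[ℝ] M := M.projectionOntoL N hc
  let Q : E →L[ℝ] N := N.projectionOntoL M hc.symm
  have hPQ : ∀ x, (P x : E) + Q x = x := fun x =>
    Submodule.projection_add_projection_eq_self hMN x
  let S : E →L[ℝ] E := (T.symm : E →L[ℝ] E)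
  let A := B₁ * ‖P‖ + B₂ * (‖S‖ * ‖Q‖)
  have hA : 0 ≤ A := by positivity
  intro ε hε
  refine ⟨ε / (A + 1), by positivity, fun x hx => ?_⟩
  set d := ε / (A + 1) with hd
  let e : ℤ → E := fun n => x (n + 1) - T (x n)
  have he : ∀ n, ‖e n‖ ≤ d := fun n => by rw [norm_sub_rev]; exact hx n
  obtain ⟨u, hu, hu'⟩ := h₁ (‖P‖ * d) (fun n => P (e n)) (fun n => (P (e n)).2) fun n =>
    P.le_opNorm_of_le (he n)
  obtain ⟨v, hv, hv'⟩ := h₂ (‖S‖ * (‖Q‖ * d)) (fun n => S (Q (e (-n - 1))))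
    (fun n => hTN _ (Q _).2) fun n => S.le_opNorm_of_le (Q.le_opNorm_of_le (he _))
  have hvT : ∀ n, T (v (-n)) = v (-(n + 1)) + Q (e n) := fun n => by
    have := congrArg T (hv (-(n + 1)))
    simp only [map_add, S, ContinuousLinearEquiv.coe_coe, ContinuousLinearEquiv.apply_symm_apply]
      at this
    simpa using this
  have hw : ∀ n, (fun n => x n - (u n - v (-n))) (n + 1) = T ((fun n => x n - (u n - v (-n))) n) :=
    fun n => by
      have := hPQ (e n)
      simp only [map_sub, hvT, hu]
      rw [show x (n + 1) = T (x n) + e n by simp [e]]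
      nth_rewrite 1 [← this]
      abel
  refine ⟨x 0 - (u 0 - v (-0)), fun n => ?_⟩
  rw [← eq_zpow_apply_of_step (w := fun n => x n - (u n - v (-n))) hw n]
  calc ‖x n - (u n - v (-n)) - x n‖ = ‖u n - v (-n)‖ := by rw [sub_sub_cancel_left, norm_neg]
    _ ≤ B₁ * (‖P‖ * d) + B₂ * (‖S‖ * (‖Q‖ * d)) := (norm_sub_le _ _).trans (add_le_add (hu' _) (hv' _))
    _ = A * d := by simp only [A]; ring
    _ < (A + 1) * d := by have : 0 < d := by positivity
                          linarith
    _ = ε := by rw [hd]; field_simp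

end BanachSpace

lemma exists_forall_sub_eq (g : ℤ → ℝ) : ∃ s : ℤ → ℝ, ∀ n, s (n + 1) - s n = g n := by
  refine ⟨fun n => ∑ i ∈ Finset.Ico 0 n, g i - ∑ i ∈ Finset.Ico n 0, g i, fun n => ?_⟩
  beta_reduce
  rcases le_or_gt 0 n with h | h
  · rw [← Finset.insert_Ico_right_eq_Ico_add_one h, Finset.Ico_eq_empty_of_le h,
      Finset.Ico_eq_empty_of_le (by lia : 0 ≤ n + 1)]
    simp
  · rw [← Finset.insert_Ico_add_one_left_eq_Ico h, Finset.Ico_eq_empty_of_le h.le,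
      Finset.Ico_eq_empty_of_le (by lia : n + 1 ≤ 0)]
    simp

lemma geometric_growth_of_sub_eq {γ s : ℤ → ℝ} {C D : ℝ} (hC : 1 ≤ C) (hD : 1 ≤ D)
    (hγ : ∀ n, 0 < γ n) (hs : ∀ n, s (n + 1) - s n = γ (n + 1)) (hsC : ∀ n, |s n| ≤ C * γ n)
    (hγD : ∀ n, γ n ≤ D * γ (n + 1)) (hγD' : ∀ n, γ (n + 1) ≤ D * γ n) :
    ∃ A, 0 < A ∧ ∃ t, 0 < t ∧ t < 1 ∧ (∀ n, 0 ≤ s n → ∀ m : ℕ, γ n ≤ A * t ^ m * γ (n + m)) ∧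
      ∀ n, s n < 0 → ∀ m : ℕ, γ n ≤ A * t ^ m * γ (n - m) := by
  have hC0 : 0 < C := by linarith
  have ht0 : 0 < C / (C + 1) := by positivity
  set t := C / (C + 1) with ht
  have htC : t * (C + 1) = C := by rw [ht]; field_simp
  have hup : ∀ (m : ℕ) n, 0 ≤ s n → s n ≤ t ^ m * s (n + m) := by
    intro m
    induction m with
    | zero => simp
    | succ m ih =>
      intro n hn
      have h1 := hs n
      have h2 := (abs_le.1 (hsC (n + 1))).2
      have h3 := hγ (n + 1)
      have h4 : s n ≤ t * s (n + 1) := by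
        have : s n * (C + 1) ≤ t * s (n + 1) * (C + 1) := by
          rw [mul_right_comm, htC]; nlinarith
        exact le_of_mul_le_mul_right this (by linarith)
      have h5 := ih (n + 1) (by linarith)
      calc s n ≤ t * s (n + 1) := h4
        _ ≤ t * (t ^ m * s (n + 1 + m)) := by gcongr
        _ = _ := by rw [pow_succ']; push_cast; rw [add_assoc n 1, add_comm 1 (m : ℤ)]; ring
  have hdown : ∀ (m : ℕ) n, s n ≤ 0 → -s n ≤ t ^ m * -s (n - m) := by
    intro m
    induction m with
    | zero => simp
    | succ m ih =>
      intro n hn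
      have h1 := hs (n - 1)
      have h2 := (abs_le.1 (hsC n)).1
      have h3 := hγ n
      rw [sub_add_cancel] at h1
      have h4 : -s n ≤ t * -s (n - 1) := by
        have : -s n * (C + 1) ≤ t * -s (n - 1) * (C + 1) := by
          rw [mul_right_comm, htC]; nlinarith
        exact le_of_mul_le_mul_right this (by linarith)
      have h5 := ih (n - 1) (by linarith)
      calc -s n ≤ t * -s (n - 1) := h4
        _ ≤ t * (t ^ m * -s (n - 1 - m)) := by gcongr
        _ = _ := by rw [pow_succ', mul_assoc]; push_cast; rw [sub_sub n 1, add_comm 1 (m : ℤ)]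
  refine ⟨D * D * (C + 1), by positivity, t, ht0, by rw [ht, div_lt_one] <;> linarith,
    fun n hn m => ?_, fun n hn m => ?_⟩
  · have h1 := hs n
    have h2 := hup m (n + 1) (by linarith [hγ (n + 1)])
    have h3 := (abs_le.1 (hsC (n + 1 + m))).2
    have h4 := hγD (n + m)
    have h5 := hγ (n + m)
    rw [add_right_comm] at h2 h3
    calc γ n ≤ D * γ (n + 1) := hγD n
      _ ≤ D * s (n + 1) := by gcongr; linarith
      _ ≤ D * (t ^ m * (C * (D * γ (n + m)))) := by
        gcongr; refine h2.trans ?_; gcongr; refine h3.trans ?_; gcongr; exact hγD' _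
      _ = D * D * C * t ^ m * γ (n + m) := by ring
      _ ≤ _ := by gcongr; linarith
  · have h1 := hs (n - 1)
    rw [sub_add_cancel] at h1
    have h2 := hdown m (n - 1) (by linarith [hγ n])
    have h3 := hs (n - m - 1)
    rw [sub_add_cancel] at h3
    have h4 := (abs_le.1 (hsC (n - m))).1
    have h5 := hγ (n - m)
    rw [sub_right_comm] at h2
    calc γ n ≤ -s (n - 1) := by linarith
      _ ≤ t ^ m * -s (n - m - 1) := h2
      _ ≤ t ^ m * ((C + 1) * γ (n - m)) := by gcongr; linarith
      _ = 1 * 1 * (C + 1) * t ^ m * γ (n - m) := by ring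
      _ ≤ _ := by gcongr

section Preimages

variable {X : Type*} {f : Equiv.Perm X} {W : Set X}

lemma img_eq_preimage (k : ℤ) (B : Set X) : img f k B = (f ^ (-k) : Equiv.Perm X) ⁻¹' B := by
  rw [img, Equiv.image_eq_preimage_symm, zpow_neg]
  rfl

lemma preimage_eq_img (n : ℤ) (B : Set X) : (f ^ n : Equiv.Perm X) ⁻¹' B = img f (-n) B := by
  rw [img_eq_preimage, neg_neg]

lemma preimage_zpow_preimage_zpow (m n : ℤ) (B : Set X) :
    (f ^ m : Equiv.Perm X) ⁻¹' ((f ^ n : Equiv.Perm X) ⁻¹' B) = (f ^ (n + m) : Equiv.Perm X) ⁻¹' B := by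
  rw [zpow_add, Equiv.Perm.coe_mul, preimage_comp]

/-- The part of a dissipative system made of the preimages of `W` indexed by `S`. -/
def orbitPart (f : Equiv.Perm X) (W : Set X) (S : Set ℤ) : Set X :=
  ⋃ n : S, (f ^ (n : ℤ) : Equiv.Perm X) ⁻¹' W

lemma preimage_orbitPart_subset {S : Set ℤ} {j : ℤ} (hS : ∀ n ∈ S, n + j ∈ S) :
    (f ^ j : Equiv.Perm X) ⁻¹' orbitPart f W S ⊆ orbitPart f W S := by
  simp only [orbitPart, preimage_iUnion, preimage_zpow_preimage_zpow]
  exact iUnion_subset fun n => subset_iUnion_of_subset ⟨n + j, hS n n.2⟩ Subset.rfl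

end Preimages

section MeasureTheory

variable {X : Type*} [MeasurableSpace X] {μ : Measure X} {f : Equiv.Perm X} {W : Set X}
  {p : ℝ≥0∞}

lemma CondStar.quasiMeasurePreserving {g : X → X} (h : CondStar μ g) (hg : Measurable g) :
    Measure.QuasiMeasurePreserving g μ μ := by
  obtain ⟨c, -, -, hc⟩ := h
  refine ⟨hg, Measure.AbsolutelyContinuous.mk fun s hs h0 => ?_⟩
  rw [Measure.map_apply hg hs]
  simpa [h0] using hc s hs

lemma RepsComp.comp [Fact (1 ≤ p)] {g h : X → X} {S T : Lp ℝ p μ ≃L[ℝ] Lp ℝ p μ}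
    (hS : RepsComp μ p g S) (hT : RepsComp μ p h T) (hg : Measure.QuasiMeasurePreserving g μ μ) :
    RepsComp μ p (h ∘ g) (S * T) := fun φ =>
  (hS (T φ)).trans (hg.ae_eq (hT φ))

lemma RepsComp.symm [Fact (1 ≤ p)] {T : Lp ℝ p μ ≃L[ℝ] Lp ℝ p μ}
    (hT : RepsComp μ p f T) (hf : Measure.QuasiMeasurePreserving f.symm μ μ) :
    RepsComp μ p f.symm T.symm := fun φ => by
  have h := hf.ae_eq (hT (T.symm φ))
  rw [T.apply_symm_apply] at h
  refine (h.trans (Eventually.of_forall fun x => ?_)).symm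
  simp

lemma RepsComp.pow [Fact (1 ≤ p)] {T : Lp ℝ p μ ≃L[ℝ] Lp ℝ p μ} (hT : RepsComp μ p f T)
    (hf : Measure.QuasiMeasurePreserving f μ μ) (n : ℕ) :
    RepsComp μ p (f ^ n : Equiv.Perm X) (T ^ n) := by
  induction n with
  | zero => exact fun φ => Eventually.of_forall fun x => rfl
  | succ n ih =>
    rw [pow_succ f, pow_succ' T]
    exact hT.comp ih hf

lemma quasiMeasurePreserving_pow (hf : Measure.QuasiMeasurePreserving f μ μ) (n : ℕ) :
    Measure.QuasiMeasurePreserving (f ^ n : Equiv.Perm X) μ μ := by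
  rw [Equiv.Perm.coe_pow]
  exact hf.iterate n

lemma quasiMeasurePreserving_zpow (hf : Measure.QuasiMeasurePreserving f μ μ)
    (hf' : Measure.QuasiMeasurePreserving f.symm μ μ) (n : ℤ) :
    Measure.QuasiMeasurePreserving (f ^ n : Equiv.Perm X) μ μ := by
  obtain ⟨m, rfl | rfl⟩ := n.eq_nat_or_neg
  · exact_mod_cast quasiMeasurePreserving_pow hf m
  · rw [zpow_neg, zpow_natCast, ← inv_pow]
    exact quasiMeasurePreserving_pow hf' m

lemma RepsComp.zpow [Fact (1 ≤ p)] {T : Lp ℝ p μ ≃L[ℝ] Lp ℝ p μ} (hT : RepsComp μ p f T)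
    (hf : Measure.QuasiMeasurePreserving f μ μ)
    (hf' : Measure.QuasiMeasurePreserving f.symm μ μ) (n : ℤ) :
    RepsComp μ p (f ^ n : Equiv.Perm X) (T ^ n) := by
  obtain ⟨m, rfl | rfl⟩ := n.eq_nat_or_neg
  · simpa using hT.pow hf m
  · simp only [zpow_neg, zpow_natCast, ← inv_pow]
    exact (hT.symm hf').pow hf' m

/-- The functions in `L^p` vanishing almost everywhere off `Z`. -/
def vanishingOff (μ : Measure X) (p : ℝ≥0∞) [Fact (1 ≤ p)] (Z : Set X) :
    Submodule ℝ (Lp ℝ p μ) :=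
  (LpToLpRestrictCLM X ℝ ℝ μ p Zᶜ).ker

lemma mem_vanishingOff [Fact (1 ≤ p)] {Z : Set X} (hZ : MeasurableSet Z) {φ : Lp ℝ p μ} :
    φ ∈ vanishingOff μ p Z ↔ ∀ᵐ x ∂μ, x ∉ Z → φ x = 0 := by
  have h1 := LpToLpRestrictCLM_coeFn (𝕜 := ℝ) Zᶜ φ
  have h2 : (∀ᵐ x ∂μ, x ∉ Z → φ x = 0) ↔ ⇑φ =ᵐ[μ.restrict Zᶜ] 0 :=
    (ae_restrict_iff' hZ.compl).symm
  rw [h2, vanishingOff, LinearMap.mem_ker]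
  change LpToLpRestrictCLM X ℝ ℝ μ p Zᶜ φ = 0 ↔ _
  rw [Lp.eq_zero_iff_ae_eq_zero]
  exact ⟨fun h => h1.symm.trans h, fun h => h1.trans h⟩

lemma isClosed_vanishingOff [Fact (1 ≤ p)] (Z : Set X) :
    IsClosed (vanishingOff μ p Z : Set (Lp ℝ p μ)) :=
  ContinuousLinearMap.isClosed_ker _

lemma isCompl_vanishingOff [Fact (1 ≤ p)] {Z : Set X} (hZ : MeasurableSet Z) :
    IsCompl (vanishingOff μ p Z) (vanishingOff μ p Zᶜ) := by
  constructor
  · rw [Submodule.disjoint_def]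
    intro φ h1 h2
    rw [mem_vanishingOff hZ] at h1
    rw [mem_vanishingOff hZ.compl] at h2
    rw [Lp.eq_zero_iff_ae_eq_zero]
    filter_upwards [h1, h2] with x h1 h2
    by_cases hx : x ∈ Z
    · exact h2 (by simpa)
    · exact h1 hx
  · rw [codisjoint_iff, Submodule.eq_top_iff']
    intro φ
    have hφ := Lp.memLp φ
    have key : ∀ A : Set X, ∀ hA : MeasurableSet A,
        (hφ.indicator hA).toLp ∈ vanishingOff μ p A := fun A hA => by
      rw [mem_vanishingOff hA]
      filter_upwards [(hφ.indicator hA).coeFn_toLp] with x hx hxA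
      rw [hx, Set.indicator_of_notMem hxA]
    refine Submodule.mem_sup.2 ⟨_, key Z hZ, _, key Zᶜ hZ.compl, ?_⟩
    rw [← MemLp.toLp_add]
    conv_rhs => rw [← Lp.toLp_coeFn φ hφ]
    congr 1
    exact Set.indicator_self_add_compl _ _

lemma RepsComp.apply_mem_vanishingOff [Fact (1 ≤ p)] {g : X → X} {T : Lp ℝ p μ ≃L[ℝ] Lp ℝ p μ}
    (hT : RepsComp μ p g T) (hg : Measure.QuasiMeasurePreserving g μ μ) {Z : Set X}
    (hZ : MeasurableSet Z) (hgZ : g ⁻¹' Z ⊆ Z) {φ : Lp ℝ p μ} (hφ : φ ∈ vanishingOff μ p Z) :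
    T φ ∈ vanishingOff μ p Z := by
  rw [mem_vanishingOff hZ] at hφ ⊢
  filter_upwards [hT φ, hg.ae hφ] with x h1 h2 hx
  rw [h1]
  exact h2 fun h => hx (hgZ h)

lemma RepsComp.enorm_apply [Fact (1 ≤ p)] {g : X → X} {T : Lp ℝ p μ ≃L[ℝ] Lp ℝ p μ}
    (hT : RepsComp μ p g T) (hg : Measure.QuasiMeasurePreserving g μ μ) (φ : Lp ℝ p μ) :
    ‖T φ‖ₑ = eLpNorm φ p (μ.map g) := by
  rw [Lp.enorm_def, eLpNorm_congr_ae (hT φ), eLpNorm_map_measure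
    ((Lp.aestronglyMeasurable φ).mono_ac hg.absolutelyContinuous) hg.aemeasurable]
  rfl

lemma RepsComp.enorm_apply_le [Fact (1 ≤ p)] {g : X → X} {T : Lp ℝ p μ ≃L[ℝ] Lp ℝ p μ}
    (hT : RepsComp μ p g T) (hg : Measure.QuasiMeasurePreserving g μ μ) {Z : Set X}
    (hZ : MeasurableSet Z) {ρ : ℝ≥0∞}
    (hρ : ∀ A, MeasurableSet A → μ (g ⁻¹' (A ∩ Z)) ≤ ρ * μ (A ∩ Z))
    {φ : Lp ℝ p μ} (hφ : φ ∈ vanishingOff μ p Z) :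
    ‖T φ‖ₑ ≤ ρ ^ (1 / p).toReal * ‖φ‖ₑ := by
  rw [mem_vanishingOff hZ] at hφ
  have hind : ⇑φ =ᵐ[μ] Z.indicator φ := by
    filter_upwards [hφ] with x hx
    by_cases h : x ∈ Z
    · simp [h]
    · simp [h, hx h]
  rw [hT.enorm_apply hg, eLpNorm_congr_ae (hg.absolutelyContinuous.ae_eq hind),
    eLpNorm_indicator_eq_eLpNorm_restrict hZ, Lp.enorm_def]
  refine eLpNorm_le_of_measure_le_smul (Measure.le_iff.2 fun A hA => ?_)
  rw [Measure.restrict_apply hA, Measure.map_apply hg.measurable (hA.inter hZ)]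
  exact (hρ A hA).trans (mul_le_mul_right (measure_mono inter_subset_left) _)

lemma measurableSet_orbitPart (hf : ∀ n : ℤ, Measurable (f ^ n : Equiv.Perm X))
    (hW : MeasurableSet W) (S : Set ℤ) : MeasurableSet (orbitPart f W S) :=
  MeasurableSet.iUnion fun n => hf n hW

lemma IsDissipative.pairwise_disjoint_preimage (h : IsDissipative μ f W) :
    Pairwise fun m n : ℤ => Disjoint ((f ^ m : Equiv.Perm X) ⁻¹' W) ((f ^ n : Equiv.Perm X) ⁻¹' W) :=
  fun m n hmn => by
    simp only [preimage_eq_img]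
    exact h.disj (neg_injective.ne hmn)

lemma IsDissipative.orbitPart_compl (h : IsDissipative μ f W) (S : Set ℤ) :
    orbitPart f W Sᶜ = (orbitPart f W S)ᶜ := by
  ext x
  have hx : x ∈ ⋃ k : ℤ, img f k W := h.cover ▸ mem_univ x
  obtain ⟨k, hk⟩ := mem_iUnion.1 hx
  rw [img_eq_preimage] at hk
  have key : ∀ S : Set ℤ, x ∈ orbitPart f W S ↔ -k ∈ S := fun S => by
    simp only [orbitPart, mem_iUnion]
    refine ⟨fun ⟨n, hn⟩ => ?_, fun hS => ⟨⟨-k, hS⟩, hk⟩⟩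
    by_contra hS
    have hne : (n : ℤ) ≠ -k := fun he => hS (he ▸ n.2)
    exact disjoint_left.1 (h.pairwise_disjoint_preimage hne) hn hk
  rw [mem_compl_iff, key, key, mem_compl_iff]

lemma BoundedDistortion.measure_preimage_mul_le {K : ℝ≥0∞} (hbd : BoundedDistortion μ f W K)
    (hK0 : K ≠ 0) (hK : K ≠ ⊤) (hW0 : μ W ≠ 0) (hW : μ W ≠ ⊤) {B : Set X} (hB : MeasurableSet B)
    (hBW : B ⊆ W) (l n : ℤ) :
    μ ((f ^ l : Equiv.Perm X) ⁻¹' B) * μ ((f ^ n : Equiv.Perm X) ⁻¹' W) ≤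
      K ^ 2 * μ ((f ^ l : Equiv.Perm X) ⁻¹' W) * μ ((f ^ n : Equiv.Perm X) ⁻¹' B) := by
  simp only [preimage_eq_img]
  have h1 := (hbd (-l) B hB hBW).2
  have h2 := (hbd (-n) B hB hBW).1
  rw [one_div, ENNReal.inv_mul_le_iff hK0 hK] at h2
  refine (ENNReal.mul_le_mul_iff_left hW0 hW).1 ?_
  calc _ = μ (img f (-l) B) * μ W * μ (img f (-n) W) := by ring
    _ ≤ K * (μ (img f (-l) W) * μ B) * μ (img f (-n) W) := by gcongr
    _ = K * μ (img f (-l) W) * (μ (img f (-n) W) * μ B) := by ring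
    _ ≤ K * μ (img f (-l) W) * (K * (μ (img f (-n) B) * μ W)) := by gcongr
    _ = _ := by ring

lemma measure_preimage_inter_orbitPart_le {K ρ : ℝ≥0∞} (h : IsDissipative μ f W)
    (hbd : BoundedDistortion μ f W K) (hK0 : K ≠ 0) (hK : K ≠ ⊤)
    (hf : ∀ n : ℤ, Measurable (f ^ n : Equiv.Perm X))
    (h0 : ∀ n : ℤ, μ ((f ^ n : Equiv.Perm X) ⁻¹' W) ≠ 0)
    (htop : ∀ n : ℤ, μ ((f ^ n : Equiv.Perm X) ⁻¹' W) ≠ ⊤) {S : Set ℤ} {j : ℤ}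
    (hS : ∀ n ∈ S, μ ((f ^ (n + j) : Equiv.Perm X) ⁻¹' W) ≤ ρ * μ ((f ^ n : Equiv.Perm X) ⁻¹' W))
    {A : Set X} (hA : MeasurableSet A) :
    μ ((f ^ j : Equiv.Perm X) ⁻¹' (A ∩ orbitPart f W S)) ≤ K ^ 2 * ρ * μ (A ∩ orbitPart f W S) := by
  have hB : ∀ n : ℤ, ∃ B ⊆ W, MeasurableSet B ∧
      A ∩ (f ^ n : Equiv.Perm X) ⁻¹' W = (f ^ n : Equiv.Perm X) ⁻¹' B := fun n => by
    refine ⟨(f ^ (-n) : Equiv.Perm X) ⁻¹' A ∩ W, inter_subset_right, (hf _ hA).inter h.meas_W, ?_⟩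
    rw [preimage_inter, preimage_zpow_preimage_zpow]
    simp
  have hpart : ∀ n ∈ S, μ ((f ^ j : Equiv.Perm X) ⁻¹' (A ∩ (f ^ n : Equiv.Perm X) ⁻¹' W)) ≤
      K ^ 2 * ρ * μ (A ∩ (f ^ n : Equiv.Perm X) ⁻¹' W) := fun n hn => by
    obtain ⟨B, hBW, hBm, hBA⟩ := hB n
    rw [hBA, preimage_zpow_preimage_zpow]
    refine (ENNReal.mul_le_mul_iff_left (h0 n) (htop n)).1 ?_
    calc _ ≤ _ := hbd.measure_preimage_mul_le hK0 hK h.pos.ne' h.fin.ne hBm hBW (n + j) n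
      _ ≤ K ^ 2 * (ρ * μ ((f ^ n : Equiv.Perm X) ⁻¹' W)) * μ ((f ^ n : Equiv.Perm X) ⁻¹' B) := by
        gcongr; exact hS n hn
      _ = _ := by ring
  have hU : μ (⋃ n : S, A ∩ (f ^ (n : ℤ) : Equiv.Perm X) ⁻¹' W) =
      ∑' n : S, μ (A ∩ (f ^ (n : ℤ) : Equiv.Perm X) ⁻¹' W) :=
    measure_iUnion (fun m n hmn =>
      (h.pairwise_disjoint_preimage (Subtype.coe_injective.ne hmn)).mono
        inter_subset_right inter_subset_right) fun n => hA.inter (hf n h.meas_W)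
  rw [orbitPart, inter_iUnion, preimage_iUnion, hU, ← ENNReal.tsum_mul_left]
  exact (measure_iUnion_le _).trans (ENNReal.tsum_le_tsum fun n => hpart n n.2)

lemma RepsComp.enorm_zpow_apply [Fact (1 ≤ p)] {T : Lp ℝ p μ ≃L[ℝ] Lp ℝ p μ}
    (hT : RepsComp μ p f T) (hf : Measure.QuasiMeasurePreserving f μ μ)
    (hf' : Measure.QuasiMeasurePreserving f.symm μ μ) (hp : p ≠ ⊤) (hW : MeasurableSet W)
    (hμW : μ W ≠ ⊤) (n : ℤ) :
    ‖(T ^ n) (indicatorConstLp p hW hμW (1 : ℝ))‖ₑ =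
      μ ((f ^ n : Equiv.Perm X) ⁻¹' W) ^ (1 / p).toReal := by
  have hp0 : p ≠ 0 := (zero_lt_one.trans_le (Fact.out : 1 ≤ p)).ne'
  have hfn := quasiMeasurePreserving_zpow hf hf' n
  rw [(hT.zpow hf hf' n).enorm_apply hfn,
    eLpNorm_congr_ae (hfn.absolutelyContinuous.ae_eq indicatorConstLp_coeFn),
    eLpNorm_indicator_const hW hp0 hp, Measure.map_apply hfn.measurable hW]
  simp

lemma RepsComp.measure_preimage_eq [Fact (1 ≤ p)] {T : Lp ℝ p μ ≃L[ℝ] Lp ℝ p μ}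
    (hT : RepsComp μ p f T) (hf : Measure.QuasiMeasurePreserving f μ μ)
    (hf' : Measure.QuasiMeasurePreserving f.symm μ μ) (hp : p ≠ ⊤) (hW : MeasurableSet W)
    (hμW : μ W ≠ ⊤) (n : ℤ) :
    μ ((f ^ n : Equiv.Perm X) ⁻¹' W) =
      ‖(T ^ n) (indicatorConstLp p hW hμW (1 : ℝ))‖ₑ ^ p.toReal := by
  have hp0 : 0 < p.toReal :=
    ENNReal.toReal_pos (zero_lt_one.trans_le (Fact.out : 1 ≤ p)).ne' hp
  rw [hT.enorm_zpow_apply hf hf' hp hW hμW, ← ENNReal.rpow_mul, one_div, ENNReal.toReal_inv,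
    inv_mul_cancel₀ hp0.ne', ENNReal.rpow_one]

lemma norm_zpow_indicatorConstLp_pos [Fact (1 ≤ p)] (T : Lp ℝ p μ ≃L[ℝ] Lp ℝ p μ) (hp : p ≠ ⊤)
    (hW : MeasurableSet W) (hμW : μ W ≠ ⊤) (hμW0 : μ W ≠ 0) (n : ℤ) :
    0 < ‖(T ^ n) (indicatorConstLp p hW hμW (1 : ℝ))‖ := by
  rw [norm_pos_iff, EmbeddingLike.map_ne_zero_iff, ← norm_pos_iff,
    norm_indicatorConstLp (zero_lt_one.trans_le (Fact.out : 1 ≤ p)).ne' hp]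
  have : 0 < μ.real W := ENNReal.toReal_pos hμW0 hμW
  rw [norm_one, one_mul]
  exact Real.rpow_pos_of_pos this _

lemma RepsComp.norm_zpow_le_of_vanishingOff [Fact (1 ≤ p)] {T : Lp ℝ p μ ≃L[ℝ] Lp ℝ p μ}
    (hT : RepsComp μ p f T) (hf : Measure.QuasiMeasurePreserving f μ μ)
    (hf' : Measure.QuasiMeasurePreserving f.symm μ μ) (hp : p ≠ ⊤) (h : IsDissipative μ f W)
    {K : ℝ≥0∞} (hbd : BoundedDistortion μ f W K) (hK0 : K ≠ 0) (hK : K ≠ ⊤) {S : Set ℤ} {j : ℤ}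
    {c : ℝ} (hc : 0 ≤ c)
    (hS : ∀ n ∈ S, ‖(T ^ (n + j)) (indicatorConstLp p h.meas_W h.fin.ne (1 : ℝ))‖ ≤
      c * ‖(T ^ n) (indicatorConstLp p h.meas_W h.fin.ne (1 : ℝ))‖)
    {φ : Lp ℝ p μ} (hφ : φ ∈ vanishingOff μ p (orbitPart f W S)) :
    ‖(T ^ j) φ‖ ≤ ((K ^ 2) ^ (1 / p).toReal).toReal * c * ‖φ‖ := by
  have hp0 : 0 < p.toReal :=
    ENNReal.toReal_pos (zero_lt_one.trans_le (Fact.out : 1 ≤ p)).ne' hp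
  have hfn : ∀ n : ℤ, Measurable (f ^ n : Equiv.Perm X) := fun n =>
    (quasiMeasurePreserving_zpow hf hf' n).measurable
  have ha := hT.measure_preimage_eq hf hf' hp h.meas_W h.fin.ne
  have hpos := norm_zpow_indicatorConstLp_pos T hp h.meas_W h.fin.ne h.pos.ne'
  have hK' : (K ^ 2) ^ (1 / p).toReal ≠ ⊤ :=
    ENNReal.rpow_ne_top_of_nonneg ENNReal.toReal_nonneg (ENNReal.pow_ne_top hK)
  have key := (hT.zpow hf hf' j).enorm_apply_le (quasiMeasurePreserving_zpow hf hf' j)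
    (measurableSet_orbitPart hfn h.meas_W S) (ρ := K ^ 2 * ENNReal.ofReal c ^ p.toReal)
    (fun A hA => measure_preimage_inter_orbitPart_le h hbd hK0 hK hfn (fun n => ?_) (fun n => ?_)
      (fun n hn => ?_) hA) hφ
  · rw [ENNReal.mul_rpow_of_nonneg _ _ ENNReal.toReal_nonneg, ← ENNReal.rpow_mul, one_div,
      ENNReal.toReal_inv, mul_inv_cancel₀ hp0.ne', ENNReal.rpow_one] at key
    rw [one_div, ENNReal.toReal_inv] at hK' ⊢
    have := ENNReal.toReal_mono (ENNReal.mul_ne_top (ENNReal.mul_ne_top hK' ENNReal.ofReal_ne_top)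
      enorm_ne_top) key
    simpa [ENNReal.toReal_ofReal hc] using this
  · rw [ha n]
    exact (ENNReal.rpow_pos (enorm_pos.2 (norm_pos_iff.1 (hpos n))) enorm_ne_top).ne'
  · rw [ha n]
    exact ENNReal.rpow_ne_top_of_nonneg hp0.le enorm_ne_top
  · rw [ha, ha, ← ENNReal.mul_rpow_of_nonneg _ _ hp0.le]
    refine ENNReal.rpow_le_rpow ?_ hp0.le
    rw [← ofReal_norm, ← ofReal_norm, ← ENNReal.ofReal_mul hc]
    exact ENNReal.ofReal_le_ofReal (hS n hn)

lemma RepsComp.exists_dual [Fact (1 ≤ p)] {T : Lp ℝ p μ ≃L[ℝ] Lp ℝ p μ}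
    (hT : RepsComp μ p f T) (hf : Measure.QuasiMeasurePreserving f μ μ)
    (hf' : Measure.QuasiMeasurePreserving f.symm μ μ) (hp : p ≠ ⊤) (h : IsDissipative μ f W)
    {K : ℝ≥0∞} (hbd : BoundedDistortion μ f W K) (hK0 : K ≠ 0) (hK : K ≠ ⊤) :
    ∃ (c : Lp ℝ p μ →L[ℝ] ℝ) (Q : ℝ), 0 ≤ Q ∧ c (indicatorConstLp p h.meas_W h.fin.ne (1 : ℝ)) = 1 ∧
      ∀ (n : ℤ) (ψ : Lp ℝ p μ),
        ‖(T ^ n) (indicatorConstLp p h.meas_W h.fin.ne (1 : ℝ))‖ * |c ψ| ≤ Q * ‖(T ^ n) ψ‖ := by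
  set e := indicatorConstLp p h.meas_W h.fin.ne (1 : ℝ) with he
  let R := LpToLpRestrictCLM X ℝ ℝ μ p W
  have hR : ∀ ψ : Lp ℝ p μ, ‖R ψ‖ₑ = eLpNorm ψ p (μ.restrict W) := fun ψ => by
    rw [Lp.enorm_def]
    exact eLpNorm_congr_ae (LpToLpRestrictCLM_coeFn ℝ W ψ)
  have hRe : R e ≠ 0 := fun h0 => by
    have h1 : ⇑e =ᵐ[μ.restrict W] 0 :=
      (LpToLpRestrictCLM_coeFn ℝ W e).symm.trans ((Lp.eq_zero_iff_ae_eq_zero).1 h0)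
    have hmem := indicatorConstLp_coeFn_mem (p := p) (hs := h.meas_W) (hμs := h.fin.ne) (c := (1 : ℝ))
    have h2 : ∀ᵐ x ∂μ.restrict W, False := by
      filter_upwards [h1, ae_restrict_of_ae hmem,
        ae_restrict_mem h.meas_W] with x h1 h2 h3
      exact one_ne_zero ((h2 h3).symm.trans h1)
    rw [eventually_false_iff_eq_bot, ae_eq_bot, Measure.restrict_eq_zero] at h2
    exact h.pos.ne' h2
  obtain ⟨g, hg1, hg⟩ := exists_dual_vector ℝ (R e) (norm_ne_zero_iff.2 hRe)
  set q := (K ^ 2 * μ W) ^ (1 / p).toReal with hq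
  have hqtop : q ≠ ⊤ := ENNReal.rpow_ne_top_of_nonneg ENNReal.toReal_nonneg
    (ENNReal.mul_ne_top (ENNReal.pow_ne_top hK) h.fin.ne)
  have hw : 0 < ‖R e‖ := norm_pos_iff.2 hRe
  refine ⟨‖R e‖⁻¹ • g.comp R, ‖R e‖⁻¹ * q.toReal, by positivity, ?_, fun n ψ => ?_⟩
  · simp [hg, hw.ne']
  · have hfn := quasiMeasurePreserving_zpow hf hf' n
    have hmeas : μ ((f ^ n : Equiv.Perm X) ⁻¹' W) • μ.restrict W ≤
        (K ^ 2 * μ W) • μ.map (f ^ n : Equiv.Perm X) := by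
      refine Measure.le_iff.2 fun A hA => ?_
      have := hbd.measure_preimage_mul_le hK0 hK h.pos.ne' h.fin.ne (hA.inter h.meas_W)
        inter_subset_right 0 n
      simp only [zpow_zero, Equiv.Perm.coe_one, preimage_id] at this
      simp only [Measure.smul_apply, smul_eq_mul, Measure.restrict_apply hA,
        Measure.map_apply hfn.measurable hA]
      rw [mul_comm]
      exact this.trans (by gcongr; exact inter_subset_left)
    have h1 := eLpNorm_le_of_measure_le_smul hmeas (f := ψ) (p := p)
    rw [eLpNorm_smul_measure_of_ne_top hp, ← hT.enorm_zpow_apply hf hf' hp h.meas_W h.fin.ne,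
      ← hR, ← (hT.zpow hf hf' n).enorm_apply hfn, smul_eq_mul, smul_eq_mul, ← he, ← hq] at h1
    have h2 := ENNReal.toReal_mono (ENNReal.mul_ne_top hqtop enorm_ne_top) h1
    simp only [ENNReal.toReal_mul, toReal_enorm] at h2
    have h3 : |g (R ψ)| ≤ ‖R ψ‖ := by simpa [hg1] using g.le_opNorm (R ψ)
    calc _ = ‖R e‖⁻¹ * (‖(T ^ n) e‖ * |g (R ψ)|) := by
          simp [abs_mul]; ring
      _ ≤ ‖R e‖⁻¹ * (‖(T ^ n) e‖ * ‖R ψ‖) := by gcongr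
      _ ≤ ‖R e‖⁻¹ * (q.toReal * ‖(T ^ n) ψ‖) := by gcongr
      _ = _ := by ring

lemma RepsComp.exists_geometric_bounds_of_hasShadowing [Fact (1 ≤ p)]
    {T : Lp ℝ p μ ≃L[ℝ] Lp ℝ p μ} (hT : RepsComp μ p f T)
    (hf : Measure.QuasiMeasurePreserving f μ μ)
    (hf' : Measure.QuasiMeasurePreserving f.symm μ μ) (hp : p ≠ ⊤) (h : IsDissipative μ f W)
    {K : ℝ≥0∞} (hbd : BoundedDistortion μ f W K) (hK0 : K ≠ 0) (hK : K ≠ ⊤)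
    (hsh : HasShadowing T) :
    ∃ S : Set ℤ, (∀ n ∈ S, n + 1 ∈ S) ∧ ∃ A, 0 < A ∧ ∃ t, 0 < t ∧ t < 1 ∧
      (∀ n ∈ S, ∀ m : ℕ, ‖(T ^ (n + m)) (indicatorConstLp p h.meas_W h.fin.ne (1 : ℝ))‖ ≤
        A * t ^ m * ‖(T ^ n) (indicatorConstLp p h.meas_W h.fin.ne (1 : ℝ))‖) ∧
      ∀ n ∉ S, ∀ m : ℕ, ‖(T ^ (n - m)) (indicatorConstLp p h.meas_W h.fin.ne (1 : ℝ))‖ ≤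
        A * t ^ m * ‖(T ^ n) (indicatorConstLp p h.meas_W h.fin.ne (1 : ℝ))‖ := by
  obtain ⟨c, Q, hQ0, hce, hcQ⟩ := hT.exists_dual hf hf' hp h hbd hK0 hK
  have hpos := norm_zpow_indicatorConstLp_pos T hp h.meas_W h.fin.ne h.pos.ne'
  set e := indicatorConstLp p h.meas_W h.fin.ne (1 : ℝ)
  have hstep : ∀ n : ℤ, (T ^ (n + 1)) e = T ((T ^ n) e) := fun n => by
    rw [add_comm, zpow_add, zpow_one]; rfl
  obtain ⟨δ, hδ, hsh⟩ := hsh 1 one_pos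
  obtain ⟨σ, hσ⟩ := exists_forall_sub_eq fun n => δ * ‖(T ^ (n + 1)) e‖⁻¹
  obtain ⟨y, hy⟩ := hsh (fun n => σ n • (T ^ n) e) fun n => by
    rw [map_smul, ← hstep, ← sub_smul, norm_smul, ← neg_sub, hσ, norm_neg, Real.norm_eq_abs,
      abs_of_pos (mul_pos hδ (inv_pos.2 (hpos _))), mul_assoc, inv_mul_cancel₀ (hpos _).ne',
      mul_one]
  have hsmall : ∀ n, |σ n - c y| ≤ Q * ‖(T ^ n) e‖⁻¹ := fun n => by
    have h1 := hcQ n (σ n • e - y)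
    have h2 : ‖(T ^ n) (σ n • e - y)‖ ≤ 1 := by
      rw [map_sub, map_smul, norm_sub_rev]
      exact (hy n).le
    rw [map_sub, map_smul, hce, smul_eq_mul, mul_one] at h1
    rw [← div_eq_mul_inv, le_div_iff₀ (hpos n), mul_comm]
    exact h1.trans (mul_le_of_le_one_right hQ0 h2)
  let U : Lp ℝ p μ →L[ℝ] Lp ℝ p μ := T
  let V : Lp ℝ p μ →L[ℝ] Lp ℝ p μ := T.symm
  set D := 1 + ‖U‖ + ‖V‖ with hD
  have hU := norm_nonneg U
  have hV := norm_nonneg V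
  have hD0 : 0 < D := by positivity
  have hup : ∀ n : ℤ, ‖(T ^ (n + 1)) e‖ ≤ D * ‖(T ^ n) e‖ := fun n => by
    rw [hstep]
    exact (U.le_opNorm _).trans (by gcongr; linarith)
  have hdown : ∀ n : ℤ, ‖(T ^ n) e‖ ≤ D * ‖(T ^ (n + 1)) e‖ := fun n => by
    have h1 : (T ^ n) e = V ((T ^ (n + 1)) e) := by
      rw [hstep]; exact (T.symm_apply_apply _).symm
    rw [h1]
    exact (V.le_opNorm _).trans (by gcongr; linarith)
  have hinv : ∀ {a b d : ℝ}, 0 < a → 0 < b → a ≤ d * b → b⁻¹ ≤ d * a⁻¹ := fun ha hb hab => by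
    rwa [inv_eq_one_div, ← div_eq_mul_inv, div_le_div_iff₀ hb ha, one_mul]
  have hinv' : ∀ {a b d : ℝ}, 0 < a → 0 < b → b⁻¹ ≤ d * a⁻¹ → a ≤ d * b := fun ha hb hab => by
    rwa [inv_eq_one_div, ← div_eq_mul_inv, div_le_div_iff₀ hb ha, one_mul] at hab
  obtain ⟨A, hA, t, ht0, ht1, h1, h2⟩ := geometric_growth_of_sub_eq
    (γ := fun n => ‖(T ^ n) e‖⁻¹) (s := fun n => (σ n - c y) / δ) (C := Q / δ + 1) (D := D)
    (by linarith [div_nonneg hQ0 hδ.le]) (by linarith) (fun n => inv_pos.2 (hpos n))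
    (fun n => by
      rw [← sub_div, sub_sub_sub_cancel_right, hσ]
      field_simp)
    (fun n => by
      have h3 := inv_pos.2 (hpos n)
      rw [abs_div, abs_of_pos hδ, div_le_iff₀ hδ]
      refine (hsmall n).trans ?_
      have h4 : (Q / δ + 1) * ‖(T ^ n) e‖⁻¹ * δ = Q * ‖(T ^ n) e‖⁻¹ + ‖(T ^ n) e‖⁻¹ * δ := by
        field_simp
      rw [h4]
      nlinarith)
    (fun n => hinv (hpos _) (hpos _) (hup n)) (fun n => hinv (hpos _) (hpos _) (hdown n))
  refine ⟨{n | 0 ≤ (σ n - c y) / δ}, fun n hn => ?_, A, hA, t, ht0, ht1, fun n hn m => ?_,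
    fun n hn m => ?_⟩
  · refine le_trans (b := (σ n - c y) / δ) hn ?_
    have h3 : 0 < δ * ‖(T ^ (n + 1)) e‖⁻¹ := mul_pos hδ (inv_pos.2 (hpos _))
    have h4 := hσ n
    gcongr
    linarith
  · exact hinv' (hpos _) (hpos _) (h1 n hn m)
  · exact hinv' (hpos _) (hpos _) (h2 n (not_le.1 hn) m)

theorem RepsComp.generalizedHyperbolic_of_hasShadowing [Fact (1 ≤ p)]
    {T : Lp ℝ p μ ≃L[ℝ] Lp ℝ p μ} (hT : RepsComp μ p f T)
    (hf : Measure.QuasiMeasurePreserving f μ μ)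
    (hf' : Measure.QuasiMeasurePreserving f.symm μ μ) (hp : p ≠ ⊤) (h : IsDissipative μ f W)
    {K : ℝ≥0∞} (hbd : BoundedDistortion μ f W K) (hK0 : K ≠ 0) (hK : K ≠ ⊤)
    (hsh : HasShadowing T) : GeneralizedHyperbolic T := by
  obtain ⟨S, hS, A, hA, t, ht0, ht1, h1, h2⟩ :=
    hT.exists_geometric_bounds_of_hasShadowing hf hf' hp h hbd hK0 hK hsh
  have hfn : ∀ n : ℤ, Measurable (f ^ n : Equiv.Perm X) := fun n =>
    (quasiMeasurePreserving_zpow hf hf' n).measurable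
  have hmeas := measurableSet_orbitPart hfn h.meas_W
  have hcompl : IsCompl (vanishingOff μ p (orbitPart f W S))
      (vanishingOff μ p (orbitPart f W Sᶜ)) := by
    rw [h.orbitPart_compl]
    exact isCompl_vanishingOff (hmeas S)
  have hB : 0 < (K ^ 2) ^ (1 / p).toReal :=
    ENNReal.rpow_pos (ENNReal.pow_pos (pos_iff_ne_zero.2 hK0) 2) (ENNReal.pow_ne_top hK)
  have hB' : 0 < ((K ^ 2) ^ (1 / p).toReal).toReal := ENNReal.toReal_pos hB.ne'
    (ENNReal.rpow_ne_top_of_nonneg ENNReal.toReal_nonneg (ENNReal.pow_ne_top hK))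
  refine ⟨_, _, isClosed_vanishingOff _, isClosed_vanishingOff _, hcompl, fun φ hφ => ?_,
    fun φ hφ => ?_, ⟨_, mul_pos hB' hA, t, ht0, ht1, fun m φ hφ => ?_⟩,
    ⟨_, mul_pos hB' hA, t, ht0, ht1, fun m φ hφ => ?_⟩⟩
  · refine hT.apply_mem_vanishingOff hf (hmeas S) ?_ hφ
    simpa using preimage_orbitPart_subset (f := f) (W := W) (j := 1) hS
  · refine (hT.symm hf').apply_mem_vanishingOff hf' (hmeas Sᶜ) ?_ hφ
    have hS' : ∀ n ∈ Sᶜ, n + -1 ∈ Sᶜ := fun n hn hn' => hn (by simpa using hS _ hn')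
    simpa using preimage_orbitPart_subset (f := f) (W := W) hS'
  · rw [mul_assoc _ A, ← zpow_natCast T]
    exact hT.norm_zpow_le_of_vanishingOff hf hf' hp h hbd hK0 hK (by positivity)
      (fun n hn => h1 n hn m) hφ
  · have hpow : T.symm ^ m = T ^ (-m : ℤ) := by
      rw [zpow_neg, zpow_natCast, ← inv_pow]; rfl
    rw [mul_assoc _ A, hpow]
    exact hT.norm_zpow_le_of_vanishingOff hf hf' hp h hbd hK0 hK (by positivity)
      (fun n hn => h2 n hn m) hφ

end MeasureTheory

/-- Corollary GH: for composition operators on dissipative systems of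
bounded distortion, generalized hyperbolicity is equivalent to the shadowing property. -/
theorem generalizedHyperbolic_iff_shadowing
    {X : Type*} [MeasurableSpace X] (μ : Measure X) (f : Equiv.Perm X) (W : Set X)
    (p : ℝ≥0∞) [Fact (1 ≤ p)] (hp : p ≠ ⊤)
    (hdiss : IsDissipative μ f W)
    (K : ℝ≥0∞) (hK0 : 0 < K) (hKfin : K ≠ ⊤)
    (hbd : BoundedDistortion μ f W K)
    (hstar : CondStar μ f) (hstar' : CondStar μ f.symm)
    (T : Lp ℝ p μ ≃L[ℝ] Lp ℝ p μ) (hT : RepsComp μ p f T) :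
    GeneralizedHyperbolic T ↔ HasShadowing T := by
  have hf := hstar.quasiMeasurePreserving hdiss.meas_f
  have hf' := hstar'.quasiMeasurePreserving hdiss.meas_symm
  exact ⟨fun h => h.hasShadowing, fun h =>
    hT.generalizedHyperbolic_of_hasShadowing hf hf' hp hdiss hbd hK0.ne' hKfin h⟩

end GHShadow
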